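/- Let m, n, d ≥ 1 be integers with m < n, and set α = ⌊md/(n−m)⌋ and s = md mod (n−m). Let G_rp denote the block-diagonal pencil (direct sum) consisting of s copies of L_{α+d} and n−m−s copies of L_{α+d−1}, a pencil of size (m+n(d−1)) × nd. Then there exists an m×n complex matrix polynomial P of grade d with leading coefficient A_d ≠ 0 (i.e., of degree exactly d) and normal rank exactly m whose first companion form C¹_P is strictly equivalent to G_rp. -/

import Mathlib

open Matrix Finset

namespace MPoly

/-- The space `POL_{d,m×n}` of `m × n` complex matrix polynomials of grade `d`,
identified with the tuple of coefficients `(A_0, …, A_d)`. -/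
abbrev Pol (d m n : ℕ) := Fin (d+1) → Matrix (Fin m) (Fin n) ℂ

/-- A matrix pencil `λ A + B` of size `p × q`, identified with the pair `(A, B)`. -/
abbrev Pencil (p q : ℕ) := Matrix (Fin p) (Fin q) ℂ × Matrix (Fin p) (Fin q) ℂ

/-- The metric on `POL_{d,m×n}`:  `dist(P,P') = (Σ_i ‖A_i − A'_i‖_F²)^(1/2)`. -/
noncomputable def polDist {m n d : ℕ} (P P' : Pol d m n) : ℝ :=
  Real.sqrt (∑ k, ∑ i, ∑ j, ‖P k i j - P' k i j‖ ^ 2)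

/-- The Frobenius norm of a matrix polynomial: `‖P‖_F = (Σ_i ‖A_i‖_F²)^(1/2)`. -/
noncomputable def polNorm {m n d : ℕ} (P : Pol d m n) : ℝ :=
  Real.sqrt (∑ k, ∑ i, ∑ j, ‖P k i j‖ ^ 2)

/-- The metric on pencils: `dist(λA+B, λA'+B') = (‖A−A'‖_F² + ‖B−B'‖_F²)^(1/2)`. -/
noncomputable def penDist {p q : ℕ} (L L' : Pencil p q) : ℝ :=
  Real.sqrt ((∑ i, ∑ j, ‖L.1 i j - L'.1 i j‖ ^ 2) + (∑ i, ∑ j, ‖L.2 i j - L'.2 i j‖ ^ 2))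

/-- The `λ`-part `A = diag(A_d, I_n, …, I_n)` of the first companion form. -/
noncomputable def compA (m n d : ℕ) (P : Pol d m n) :
    Matrix (Fin (m + n*(d-1))) (Fin (n*d)) ℂ := fun i j =>
  if hi : (i : ℕ) < m then
    if hj : (j : ℕ) < n then P (Fin.last d) ⟨i, hi⟩ ⟨j, hj⟩ else 0
  else if (i : ℕ) - m = (j : ℕ) - n ∧ n ≤ (j : ℕ) then 1 else 0

/-- The constant part `B` of the first companion form: first block row
`(A_{d-1}, …, A_0)`, with `−I_n` in block entries `(i+1, i)`. -/
noncomputable def compB (m n d : ℕ) (P : Pol d m n) :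
    Matrix (Fin (m + n*(d-1))) (Fin (n*d)) ℂ := fun i j =>
  if hi : (i : ℕ) < m then
    if hn : 0 < n then
      P ⟨d - 1 - (j : ℕ) / n, Nat.lt_succ_of_le ((Nat.sub_le _ _).trans (Nat.sub_le d 1))⟩ ⟨i, hi⟩ ⟨(j : ℕ) % n, Nat.mod_lt _ hn⟩
    else 0
  else if (j : ℕ) = (i : ℕ) - m then -1 else 0

/-- The first Frobenius companion form `C¹_P` of a matrix polynomial. -/
noncomputable def comp (m n d : ℕ) (P : Pol d m n) : Pencil (m + n*(d-1)) (n*d) :=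
  (compA m n d P, compB m n d P)

/-- Strict equivalence of matrix pencils: `Q⁻¹ (λA+B) R = λC+D` for invertible `Q, R`. -/
def StrictEquiv {p q : ℕ} (L M : Pencil p q) : Prop :=
  ∃ (Q : Matrix (Fin p) (Fin p) ℂ) (R : Matrix (Fin q) (Fin q) ℂ),
    IsUnit Q ∧ IsUnit R ∧ Q⁻¹ * L.1 * R = M.1 ∧ Q⁻¹ * L.2 * R = M.2

/-- The strict equivalence orbit of a pencil. -/
def orbE {p q : ℕ} (L : Pencil p q) : Set (Pencil p q) := {M | StrictEquiv L M}

/-- The generalized Sylvester space `GSYL¹_{d,m×n}` of all first companion forms. -/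
def GSYL (m n d : ℕ) : Set (Pencil (m + n*(d-1)) (n*d)) := Set.range (comp m n d)

/-- A matrix polynomial viewed as a matrix over the field `ℂ(λ)` of rational functions. -/
noncomputable def ratMatrix {m n d : ℕ} (P : Pol d m n) :
    Matrix (Fin m) (Fin n) (RatFunc ℂ) :=
  fun i j => ∑ k : Fin (d+1), RatFunc.C (P k i j) * RatFunc.X ^ (k : ℕ)

/-- The normal rank of a matrix polynomial: its rank over `ℂ(λ)`. -/
noncomputable def nrank {m n d : ℕ} (P : Pol d m n) : ℕ := (ratMatrix P).rank

/-- Offset of the `b`-th diagonal block when block `j` has size `sz j`. -/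
def off (sz : ℕ → ℕ) (b : ℕ) : ℕ := ∑ j ∈ Finset.range b, sz j

/-- The `p × q` matrix given as a direct sum of `N` diagonal blocks, where block `b`
has size `ρ b × γ b` and entries `ent b`, blocks being laid out along the diagonal
in order (block `b` occupies rows `[off ρ b, off ρ b + ρ b)` and columns
`[off γ b, off γ b + γ b)`); all other entries are zero. -/
noncomputable def dsum (N : ℕ) (ρ γ : ℕ → ℕ) (ent : ℕ → ℕ → ℕ → ℂ) (p q : ℕ) :
    Matrix (Fin p) (Fin q) ℂ := fun x y =>
  ∑ b ∈ Finset.range N,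
    if off ρ b ≤ (x:ℕ) ∧ (x:ℕ) < off ρ b + ρ b ∧ off γ b ≤ (y:ℕ) ∧ (y:ℕ) < off γ b + γ b
    then ent b ((x:ℕ) - off ρ b) ((y:ℕ) - off γ b) else 0

/-- Sizes of the four sections of blocks: `c₁` blocks of size `v₁`, then `c₂` of size
`v₂`, then `c₃` of size `v₃`, then the rest of size `v₄`. -/
def secSize (c₁ c₂ c₃ : ℕ) (v₁ v₂ v₃ v₄ : ℕ) (i : ℕ) : ℕ :=
  if i < c₁ then v₁ else if i < c₁ + c₂ then v₂ else if i < c₁ + c₂ + c₃ then v₃ else v₄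

/-- The `p × q` pencil which is the direct sum of `c₁` copies of `L_{e₁}`, `c₂` copies
of `L_{e₂}`, `c₃` copies of `L_{f₁}ᵀ` and `c₄` copies of `L_{f₂}ᵀ`.  Here `L_k` is the
`k × (k+1)` pencil `λ G_k + F_k` with `G_k` having ones in entries `(i,i)` and `F_k`
having ones in entries `(i,i+1)`. -/
noncomputable def genPencil (c₁ c₂ c₃ c₄ e₁ e₂ f₁ f₂ p q : ℕ) : Pencil p q :=
  (dsum (c₁+c₂+c₃+c₄) (secSize c₁ c₂ c₃ e₁ e₂ (f₁+1) (f₂+1))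
     (secSize c₁ c₂ c₃ (e₁+1) (e₂+1) f₁ f₂)
     (fun _ i j => if i = j then 1 else 0) p q,
   dsum (c₁+c₂+c₃+c₄) (secSize c₁ c₂ c₃ e₁ e₂ (f₁+1) (f₂+1))
     (secSize c₁ c₂ c₃ (e₁+1) (e₂+1) f₁ f₂)
     (fun b i j => if b < c₁ + c₂ then (if j = i+1 then 1 else 0)
       else (if i = j+1 then 1 else 0)) p q)

/-- The generic pencil `G_a` of Theorem 3.2 (viewed at grade `d`):  the direct sum of
`s` copies of `L_{α+d}`, `n−r−s` copies of `L_{α+d−1}`, `t` copies of `L_{β+1}ᵀ` and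
`m−r−t` copies of `L_βᵀ`, where `α = ⌊a/(n−r)⌋`, `s = a mod (n−r)`,
`β = ⌊(rd−a)/(m−r)⌋`, `t = (rd−a) mod (m−r)`. -/
noncomputable def Ga (m n d r a : ℕ) : Pencil (m + n*(d-1)) (n*d) :=
  genPencil (a % (n-r)) (n-r - a % (n-r)) ((r*d - a) % (m-r)) (m-r - (r*d - a) % (m-r))
    (a/(n-r) + d) (a/(n-r) + d - 1) ((r*d - a)/(m-r) + 1) ((r*d - a)/(m-r))
    (m + n*(d-1)) (n*d)


/-- The generic rank-`ρ` pencil of size `p × q` with parameter `b` (Theorem 3.2 of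
De Terán–Dopico): direct sum of `s₁` copies of `L_{α₁+1}`, `q−ρ−s₁` copies of `L_{α₁}`,
`t₁` copies of `L_{β₁+1}ᵀ` and `p−ρ−t₁` copies of `L_{β₁}ᵀ`, where `α₁ = ⌊b/(q−ρ)⌋`,
`s₁ = b mod (q−ρ)`, `β₁ = ⌊(ρ−b)/(p−ρ)⌋`, `t₁ = (ρ−b) mod (p−ρ)`. -/
noncomputable def Kp (p q ρ b : ℕ) : Pencil p q :=
  genPencil (b % (q-ρ)) (q-ρ - b % (q-ρ)) ((ρ-b) % (p-ρ)) (p-ρ - (ρ-b) % (p-ρ))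
    (b/(q-ρ) + 1) (b/(q-ρ)) ((ρ-b)/(p-ρ) + 1) ((ρ-b)/(p-ρ)) p q

/-- The generic right-singular pencil `G_rp` (case `m < n`): direct sum of `s` copies of
`L_{α+d}` and `n−m−s` copies of `L_{α+d−1}`, with `α = ⌊md/(n−m)⌋`, `s = md mod (n−m)`. -/
noncomputable def Grp (m n d : ℕ) : Pencil (m + n*(d-1)) (n*d) :=
  genPencil (m*d % (n-m)) (n-m - m*d % (n-m)) 0 0
    (m*d/(n-m) + d) (m*d/(n-m) + d - 1) 0 0 (m + n*(d-1)) (n*d)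

/-- The generic left-singular pencil `G_ℓp` (case `m > n`): direct sum of `t` copies of
`L_{β+1}ᵀ` and `m−n−t` copies of `L_βᵀ`, with `β = ⌊nd/(m−n)⌋`, `t = nd mod (m−n)`. -/
noncomputable def Glp (m n d : ℕ) : Pencil (m + n*(d-1)) (n*d) :=
  genPencil 0 0 (n*d % (m-n)) (m-n - n*d % (m-n)) 0 0
    (n*d/(m-n) + 1) (n*d/(m-n)) (m + n*(d-1)) (n*d)

/-- The linear map `(X, Y) ↦ (XA − AY, XB − BY)` whose range is the tangent space at
`λA+B` to the strict equivalence orbit of the pencil `λA+B`. -/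
noncomputable def tangentMap {p q : ℕ} (L : Pencil p q) :
    (Matrix (Fin p) (Fin p) ℂ × Matrix (Fin q) (Fin q) ℂ) →ₗ[ℂ]
      (Matrix (Fin p) (Fin q) ℂ × Matrix (Fin p) (Fin q) ℂ) where
  toFun XY := (XY.1 * L.1 - L.1 * XY.2, XY.1 * L.2 - L.2 * XY.2)
  map_add' X Y := by
    obtain ⟨X₁, X₂⟩ := X; obtain ⟨Y₁, Y₂⟩ := Y
    simp only [Prod.mk_add_mk, Matrix.add_mul, Matrix.mul_add, Prod.mk.injEq]
    constructor <;> abel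
  map_smul' c X := by
    obtain ⟨X₁, X₂⟩ := X
    simp only [Prod.smul_mk, Matrix.smul_mul, Matrix.mul_smul, RingHom.id_apply,
      Prod.mk.injEq, smul_sub]

/-- The tangent space `T = {(XA − AY, XB − BY)}` at `λA+B` to its strict equivalence
orbit, as a subspace of the pencil space. -/
noncomputable def tangent {p q : ℕ} (L : Pencil p q) :
    Submodule ℂ (Matrix (Fin p) (Fin q) ℂ × Matrix (Fin p) (Fin q) ℂ) :=
  LinearMap.range (tangentMap L)

/-- The first companion form `C¹_M(λ) = λ A + B` regarded as a matrix over `ℂ[λ]`. -/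
noncomputable def compPoly (m n d : ℕ) (M : Pol d m n) :
    Matrix (Fin (m + n*(d-1))) (Fin (n*d)) (Polynomial ℂ) := fun i j =>
  Polynomial.C (compA m n d M i j) * Polynomial.X + Polynomial.C (compB m n d M i j)

/-- The block-diagonal matrix `diag(M(λ), I_{n(d−1)})` over `ℂ[λ]`. -/
noncomputable def polyBlock (m n d : ℕ) (M : Pol d m n) :
    Matrix (Fin (m + n*(d-1))) (Fin (n*d)) (Polynomial ℂ) := fun i j =>
  if hi : (i : ℕ) < m then
    if hj : (j : ℕ) < n then
      ∑ k : Fin (d+1), Polynomial.C (M k ⟨i, hi⟩ ⟨j, hj⟩) * Polynomial.X ^ (k : ℕ)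
    else 0
  else if (i : ℕ) - m = (j : ℕ) - n ∧ n ≤ (j : ℕ) then 1 else 0

/-- The first companion form regarded as a matrix over the field `ℂ(λ)`. -/
noncomputable def compRat (m n d : ℕ) (M : Pol d m n) :
    Matrix (Fin (m + n*(d-1))) (Fin (n*d)) (RatFunc ℂ) := fun i j =>
  RatFunc.C (compA m n d M i j) * RatFunc.X + RatFunc.C (compB m n d M i j)


theorem off_succ (sz : ℕ → ℕ) (b : ℕ) : off sz (b+1) = off sz b + sz b := by
  simp [off, Finset.sum_range_succ]

theorem off_mono (sz : ℕ → ℕ) {b c : ℕ} (h : b ≤ c) : off sz b ≤ off sz c :=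
  Finset.sum_le_sum_of_subset (Finset.range_mono h)

theorem off_lt_le (sz : ℕ → ℕ) {b c : ℕ} (h : b < c) : off sz b + sz b ≤ off sz c := by
  rw [← off_succ]; exact off_mono sz h

theorem off_find (sz : ℕ → ℕ) (k y : ℕ) (h : y < off sz k) :
    ∃ b < k, off sz b ≤ y ∧ y < off sz b + sz b := by
  induction k with
  | zero => simp [off] at h
  | succ k ih =>
    by_cases h' : y < off sz k
    · obtain ⟨b, hb, h1⟩ := ih h'
      exact ⟨b, by omega, h1⟩
    · exact ⟨k, by omega, by omega, by rw [← off_succ]; exact h⟩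

theorem off_unique (sz : ℕ → ℕ) {b c y : ℕ} (h1 : off sz b ≤ y) (h2 : y < off sz b + sz b)
    (h3 : off sz c ≤ y) (h4 : y < off sz c + sz c) : b = c := by
  rcases lt_trichotomy b c with h | h | h
  · have := off_lt_le sz h; omega
  · exact h
  · have := off_lt_le sz h; omega

/-- Row `i` meets block `b`. -/
def act (d : ℕ) (γ : ℕ → ℕ) (i b : ℕ) : Prop :=
  off γ b < i * d + d ∧ i * d < off γ b + γ b

/-- The exponent of the monomial in position `(i, b)`. -/
def expo (d : ℕ) (γ : ℕ → ℕ) (i b : ℕ) : ℕ := min (i * d - off γ b) (γ b - d)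

open Classical in
/-- The generalized Sylvester coefficients: coefficient of `λ^j` in `λ^t N_{i,b}`. -/
noncomputable def syl (d : ℕ) (γ : ℕ → ℕ) (i t b j : ℕ) : ℂ :=
  if act d γ i b ∧ j = expo d γ i b + t then 1 else 0

theorem syl_single (d n : ℕ) (γ : ℕ → ℕ) (q : ℕ → ℕ → ℂ) (b j i t : ℕ) (hi : i < n) (ht : t < d)
    (h0 : ∑ i ∈ range n, ∑ t ∈ range d, q i t * syl d γ i t b j = 0)
    (h1 : act d γ i b ∧ j = expo d γ i b + t)
    (h2 : ∀ i' < n, ∀ t' < d, i' ≠ i → act d γ i' b → j = expo d γ i' b + t' → q i' t' = 0) :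
    q i t = 0 := by
  have key : ∀ i' ∈ range n, i' ≠ i → ∑ t ∈ range d, q i' t * syl d γ i' t b j = 0 := by
    intro i' hi' hne
    apply Finset.sum_eq_zero
    intro t' ht'
    unfold syl
    split_ifs with hc
    · rw [h2 i' (by simpa using hi') t' (by simpa using ht') hne hc.1 hc.2]; simp
    · simp
  rw [Finset.sum_eq_single_of_mem i (by simpa using hi) key,
    Finset.sum_eq_single_of_mem t (by simpa using ht)] at h0
  · simpa [syl, h1] using h0
  · intro t' _ hne
    have : ¬ (act d γ i b ∧ j = expo d γ i b + t') := by
      rintro ⟨_, h⟩; omega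
    simp [syl, this]

theorem syl_inj (n d k : ℕ) (γ : ℕ → ℕ) (hγ : ∀ b < k, d ≤ γ b) (htot : off γ k = n * d)
    (q : ℕ → ℕ → ℂ)
    (hq : ∀ b < k, ∀ j < γ b, ∑ i ∈ range n, ∑ t ∈ range d, q i t * syl d γ i t b j = 0) :
    ∀ i < n, ∀ t < d, q i t = 0 := by
  have cmp : ∀ i j : ℕ, i < j → i * d + d ≤ j * d := by
    intro i j h
    have := Nat.mul_le_mul_right d (Nat.succ_le_of_lt h)
    rw [Nat.succ_mul] at this; exact this
  have high : ∀ i < n, ∀ b < k, ∀ t < d, i * d < off γ b → off γ b < i * d + d →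
      i * d + d ≤ off γ b + t → q i t = 0 := by
    intro i
    induction i using Nat.strong_induction_on with
    | _ i ih =>
      intro hi b hb t ht h1 h2 h3
      obtain _ | b := b
      · simp [off] at h1
      have hs := off_succ γ b
      have hgb := hγ b (by omega)
      refine syl_single d n γ q b (γ b - d + t) i t hi ht (hq b (by omega) _ (by omega)) ?_ ?_
      · unfold act expo; omega
      · intro i' hi' t' ht' hne ha he
        unfold act at ha
        unfold expo at he
        rcases lt_or_gt_of_ne hne with hlt | hgt
        · have := cmp i' i hlt
          by_cases hc : off γ b ≤ i' * d
          · omega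
          · exact ih i' hlt hi' b (by omega) t' ht' (by omega) (by omega) (by omega)
        · have := cmp i i' hgt
          omega
  suffices H : ∀ r i, i < n → n = i + r + 1 → ∀ t < d, q i t = 0 by
    intro i hi
    exact H (n - i - 1) i hi (by omega)
  intro r
  induction r using Nat.strong_induction_on with
  | _ r ih =>
    intro i hi hr t ht
    have later : ∀ i' < n, i < i' → ∀ t < d, q i' t = 0 := fun i' hi' hlt =>
      ih (n - i' - 1) (by omega) i' hi' (by omega)
    by_cases hs : ∃ b < k, i * d < off γ b ∧ off γ b < i * d + d
    · obtain ⟨b, hb, h1, h2⟩ := hs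
      by_cases h3 : i * d + d ≤ off γ b + t
      · exact high i hi b hb t ht h1 h2 h3
      have hgb := hγ b hb
      refine syl_single d n γ q b t i t hi ht (hq b hb _ (by omega)) ?_ ?_
      · unfold act expo; omega
      · intro i' hi' t' ht' hne ha he
        unfold act at ha
        rcases lt_or_gt_of_ne hne with hlt | hgt
        · have := cmp i' i hlt
          omega
        · exact later i' hi' hgt t' ht'
    · have hid := cmp i n hi
      obtain ⟨b, hb, h1, h2⟩ := off_find γ k (i * d) (by omega)
      have hgb := hγ b hb
      have h3 : i * d + d ≤ off γ b + γ b := by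
        rw [← off_succ] at h2 ⊢
        by_cases hbk : b + 1 < k
        · by_contra hc
          exact hs ⟨b+1, hbk, by omega, by omega⟩
        · have : b + 1 = k := by omega
          rw [this]; omega
      refine syl_single d n γ q b (i * d - off γ b + t) i t hi ht (hq b hb _ (by omega)) ?_ ?_
      · unfold act expo; omega
      · intro i' hi' t' ht' hne ha he
        unfold act at ha
        unfold expo at he
        rcases lt_or_gt_of_ne hne with hlt | hgt
        · have := cmp i' i hlt
          by_cases hc : off γ b ≤ i' * d
          · omega
          · exact high i' hi' b hb t' ht' (by omega) (by omega) (by omega)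
        · exact later i' hi' hgt t' ht'

theorem syl_succ (d : ℕ) (γ : ℕ → ℕ) (i t b j : ℕ) :
    syl d γ i (t+1) b (j+1) = syl d γ i t b j := by
  unfold syl
  congr 1
  simp only [eq_iff_iff]
  apply and_congr_right
  intro _; omega

theorem syl_zero (d : ℕ) (γ : ℕ → ℕ) (i t b : ℕ) (ht : 0 < t) : syl d γ i t b 0 = 0 := by
  unfold syl
  rw [if_neg]; rintro ⟨_, h⟩; omega

theorem syl_top (d : ℕ) (γ : ℕ → ℕ) (i t b j : ℕ) (h : γ b - d + t < j) :
    syl d γ i t b j = 0 := by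
  unfold syl
  rw [if_neg]; rintro ⟨_, h⟩; unfold expo at h; omega

theorem exists_poly (m n d k : ℕ) (γ : ℕ → ℕ) (hγ : ∀ b < k, d ≤ γ b) (htot : off γ k = n * d)
    (hk : m + k = n) :
    ∃ P : Pol d m n, LinearIndependent ℂ (P (Fin.last d)) ∧
      ∀ r : Fin m, ∀ b < k, ∀ j ≤ γ b,
        ∑ i : Fin n, ∑ t : Fin (d+1), P t r i * syl d γ i t b j = 0 := by
  classical
  let Φ : (Fin n × Fin (d+1) → ℂ) →ₗ[ℂ] ((Σ b : Fin k, Fin (γ b + 1)) → ℂ) :=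
    { toFun := fun f x => ∑ i : Fin n, ∑ t : Fin (d+1), f (i, t) * syl d γ i t x.1 x.2
      map_add' := by
        intro f g; ext x
        simp [add_mul, Finset.sum_add_distrib]
      map_smul' := by
        intro c f; ext x
        simp [Finset.mul_sum, mul_assoc] }
  have h1 := LinearMap.finrank_range_add_finrank_ker Φ
  have h2 : Module.finrank ℂ (LinearMap.range Φ) ≤ n * d + k := by
    refine (Submodule.finrank_le _).trans ?_
    rw [Module.finrank_fintype_fun_eq_card, Fintype.card_sigma]
    simp only [Fintype.card_fin, Finset.sum_add_distrib]
    rw [Fin.sum_univ_eq_sum_range, ← htot]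
    simp [off]
  rw [Module.finrank_fintype_fun_eq_card, Fintype.card_prod] at h1
  simp only [Fintype.card_fin, Nat.mul_succ] at h1
  have h3 : m ≤ Module.finrank ℂ (LinearMap.ker Φ) := by omega
  obtain ⟨f, hf⟩ := exists_linearIndependent_of_le_finrank h3
  have hker : ∀ (g : LinearMap.ker Φ) (b : ℕ), b < k → ∀ j ≤ γ b,
      ∑ i : Fin n, ∑ t : Fin (d+1), g.1 (i, t) * syl d γ i t b j = 0 := by
    intro g b hb j hj
    have := congrFun (LinearMap.mem_ker.1 g.2) ⟨⟨b, hb⟩, ⟨j, by simp; omega⟩⟩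
    exact this
  refine ⟨fun t r i => (f r).1 (i, t), ?_, fun r b hb j hj => hker (f r) b hb j hj⟩
  rw [Fintype.linearIndependent_iff] at hf ⊢
  intro w hw
  apply hf w
  set g := ∑ r, w r • f r with hg
  have hgv : ∀ x, g.1 x = ∑ r, w r * (f r).1 x := by
    intro x; simp [hg]
  have hlast : ∀ i, g.1 (i, Fin.last d) = 0 := by
    intro i
    rw [hgv]
    have := congrFun hw i
    simpa using this
  have hz := syl_inj n d k γ hγ htot
    (fun i t => if h : i < n ∧ t < d then g.1 (⟨i, h.1⟩, ⟨t, by omega⟩) else 0) (by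
      intro b hb j hj
      refine Eq.trans ?_ (hker g b hb j hj.le)
      rw [← Fin.sum_univ_eq_sum_range (fun i => ∑ t ∈ range d, (if h : i < n ∧ t < d then g.1 (⟨i, h.1⟩, ⟨t, by omega⟩) else 0) * syl d γ i t b j)]
      apply Finset.sum_congr rfl
      intro i _
      rw [← Fin.sum_univ_eq_sum_range (fun t => (if h : (i:ℕ) < n ∧ t < d then g.1 (⟨i, h.1⟩, ⟨t, by omega⟩) else 0) * syl d γ i t b j)]
      rw [Fin.sum_univ_castSucc (n := d), hlast]
      simp
      rfl)
  ext ⟨i, t⟩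
  simp only [ZeroMemClass.coe_zero, Pi.zero_apply]
  by_cases ht : (t : ℕ) < d
  · have := hz i i.2 t ht
    simpa [ht] using this
  · have : t = Fin.last d := by ext; simp; omega
    rw [this, hlast]

theorem nrank_eq (m n d : ℕ) (P : Pol d m n) (h : LinearIndependent ℂ (P (Fin.last d))) :
    nrank P = m := by
  classical
  apply le_antisymm (Matrix.rank_le_height _)
  obtain ⟨X, hX⟩ : ∃ X : Matrix (Fin n) (Fin m) ℂ, P (Fin.last d) * X = 1 := by
    have := Matrix.vecMul_injective_iff.2 (show LinearIndependent ℂ (P (Fin.last d)).row from h)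
    obtain ⟨g, hg⟩ := LinearMap.exists_leftInverse_of_injective
      (Matrix.toLin' (P (Fin.last d))ᵀ) (by
        rw [LinearMap.ker_eq_bot]
        intro u v huv
        apply this
        simpa [Matrix.mulVec_transpose] using huv)
    refine ⟨(LinearMap.toMatrix' g)ᵀ, ?_⟩
    have h2 := congrArg LinearMap.toMatrix' hg
    rw [LinearMap.toMatrix'_comp, LinearMap.toMatrix'_toLin', LinearMap.toMatrix'_id] at h2
    have h3 := congrArg Matrix.transpose h2
    simpa [Matrix.transpose_mul] using h3
  let M : Matrix (Fin m) (Fin m) (Polynomial ℂ) := fun i j =>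
    ∑ k : Fin (d+1), Polynomial.C ((P k * X) i j) * Polynomial.X ^ (k : ℕ)
  have hM : ∀ i j, M i j =
    ∑ k : Fin (d+1), Polynomial.C ((P k * X) i j) * Polynomial.X ^ (k : ℕ) := fun _ _ => rfl
  clear_value M
  have hdet : M.det ≠ 0 := by
    intro h0
    let g : ℂ → ℂ := fun μ => Matrix.det (∑ k : Fin (d+1), μ ^ (d - (k : ℕ)) • (P k * X))
    have hg : Continuous g := by
      apply Continuous.matrix_det
      fun_prop
    have hg0 : g 0 = 1 := by
      simp only [g]
      rw [Finset.sum_eq_single (Fin.last d)]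
      · simp [hX]
      · intro b _ hb
        have : (b : ℕ) ≠ d := fun h => hb (by ext; simpa using h)
        rw [zero_pow (by omega), zero_smul]
      · simp
    have hne : ∀ᶠ μ in nhdsWithin (0:ℂ) {0}ᶜ, g μ ≠ 0 := by
      apply Filter.Eventually.filter_mono nhdsWithin_le_nhds
      exact hg.continuousAt.eventually_ne (by rw [hg0]; exact one_ne_zero)
    obtain ⟨μ, h1, h2⟩ := (hne.and self_mem_nhdsWithin).exists
    have h2 : μ ≠ 0 := h2
    apply h1
    have h3 : (M.map (Polynomial.eval μ⁻¹)).det = 0 := by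
      have := congrArg (Polynomial.evalRingHom μ⁻¹) h0
      rw [RingHom.map_det] at this
      simpa using this
    have h4 : (∑ k : Fin (d+1), μ ^ (d - (k : ℕ)) • (P k * X)) =
        μ ^ d • M.map (Polynomial.eval μ⁻¹) := by
      ext i j
      simp only [Matrix.sum_apply, Matrix.smul_apply, Matrix.map_apply, hM, smul_eq_mul,
        Polynomial.eval_finsetSum, Finset.mul_sum, Polynomial.eval_mul, Polynomial.eval_C,
        Polynomial.eval_pow, Polynomial.eval_X]
      apply Finset.sum_congr rfl
      intro k _
      rw [pow_sub₀ _ h2 (by omega), inv_pow]; ring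
    simp only [g]
    rw [h4, Matrix.det_smul, h3, mul_zero]
  have hmul : ratMatrix P * X.map RatFunc.C = M.map (algebraMap (Polynomial ℂ) (RatFunc ℂ)) := by
    ext i j
    simp only [Matrix.mul_apply, ratMatrix, Matrix.map_apply, hM, map_sum, map_mul, map_pow,
      RatFunc.algebraMap_C, RatFunc.algebraMap_X, Finset.sum_mul]
    rw [Finset.sum_comm]
    apply Finset.sum_congr rfl
    intro k _
    apply Finset.sum_congr rfl
    intro l _
    ring
  have hrk : (ratMatrix P * X.map RatFunc.C).rank = m := by
    rw [hmul]
    have : IsUnit (M.map (algebraMap (Polynomial ℂ) (RatFunc ℂ))) := by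
      rw [Matrix.isUnit_iff_isUnit_det, isUnit_iff_ne_zero]
      have := RingHom.map_det (algebraMap (Polynomial ℂ) (RatFunc ℂ)) M
      rw [RingHom.mapMatrix_apply] at this
      rw [← this]
      exact (map_ne_zero_iff _ (RatFunc.algebraMap_injective ℂ)).2 hdet
    rw [Matrix.rank_of_isUnit _ this, Fintype.card_fin]
  calc m = _ := hrk.symm
    _ ≤ _ := Matrix.rank_mul_le_left _ _

theorem dsum_apply (k : ℕ) (ρ γ : ℕ → ℕ) (ent : ℕ → ℕ → ℕ → ℂ) (p q : ℕ) (x : Fin p) (y : Fin q)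
    (b : ℕ) (hb : b < k) (h1 : off γ b ≤ y) (h2 : (y : ℕ) < off γ b + γ b) :
    dsum k ρ γ ent p q x y = if off ρ b ≤ (x:ℕ) ∧ (x:ℕ) < off ρ b + ρ b
      then ent b ((x:ℕ) - off ρ b) ((y:ℕ) - off γ b) else 0 := by
  unfold dsum
  rw [Finset.sum_eq_single_of_mem b (by simpa using hb)]
  · simp [h1, h2]
  · intro c _ hne
    rw [if_neg]
    rintro ⟨_, _, h3, h4⟩
    exact hne (off_unique γ h3 h4 h1 h2)

/-- Positions in `Fin (n*d)` as pairs (row index, power). -/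
def posEquiv (n d : ℕ) : Fin n × Fin d ≃ Fin (n * d) where
  toFun x := ⟨n * (d - 1 - x.2) + x.1, by
    have h1 := x.1.2
    have h2 := x.2.2
    have h3 : n * (d - 1 - x.2 + 1) ≤ n * d := Nat.mul_le_mul_left n (by omega)
    rw [Nat.mul_succ] at h3
    omega⟩
  invFun y := (⟨y % n, Nat.mod_lt _ (by
      rcases Nat.eq_zero_or_pos n with h | h
      · subst h; have := y.2; simp at this
      · exact h)⟩, ⟨d - 1 - y / n, by
      rcases Nat.eq_zero_or_pos d with h | h
      · subst h; have := y.2; simp at this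
      · exact lt_of_le_of_lt (Nat.sub_le _ _) (by omega)⟩)
  left_inv := by
    rintro ⟨i, t⟩
    have hn : 0 < n := by have := i.2; omega
    ext
    · simp [Nat.mul_add_mod, Nat.mod_eq_of_lt i.2]
    · simp [Nat.mul_add_div hn, Nat.div_eq_of_lt i.2]; omega
  right_inv := by
    intro y
    ext
    have h2 : (y : ℕ) / n < d := Nat.div_lt_of_lt_mul y.2
    have h3 : d - 1 - (d - 1 - (y : ℕ) / n) = y / n := by
      generalize (y : ℕ) / n = z at *
      omega
    simp only [h3]
    exact Nat.div_add_mod _ _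

theorem posEquiv_mod (n d : ℕ) (i : Fin n) (t : Fin d) :
    (posEquiv n d (i, t) : ℕ) % n = i := by
  simp [posEquiv, Nat.mul_add_mod, Nat.mod_eq_of_lt i.2]

theorem posEquiv_div (n d : ℕ) (i : Fin n) (t : Fin d) :
    (posEquiv n d (i, t) : ℕ) / n = d - 1 - t := by
  have hn : 0 < n := by have := i.2; omega
  simp [posEquiv, Nat.mul_add_div hn, Nat.div_eq_of_lt i.2]

theorem sum_pos (n d : ℕ) (f : Fin (n * d) → ℂ) :
    ∑ x, f x = ∑ i : Fin n, ∑ t : Fin d, f (posEquiv n d (i, t)) := by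
  rw [← (posEquiv n d).sum_comp, Fintype.sum_prod_type]

/-- The column vectors of the right transformation. -/
noncomputable def rv (n d : ℕ) (γ : ℕ → ℕ) (b j x : ℕ) : ℂ :=
  (-1) ^ j * syl d γ (x % n) (d - 1 - x / n) b j

theorem rv_pos (n d : ℕ) (γ : ℕ → ℕ) (b j : ℕ) (i : Fin n) (t : Fin d) :
    rv n d γ b j (posEquiv n d (i, t)) = (-1) ^ j * syl d γ i t b j := by
  unfold rv
  rw [posEquiv_mod, posEquiv_div]
  congr 2
  have := t.2
  omega

section
variable (m n d : ℕ) (P : Pol d m n) (γ : ℕ → ℕ)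

theorem A_low (w : Fin (m + n*(d-1))) (hw : m ≤ (w:ℕ)) (hd : 1 ≤ d) (b j : ℕ) :
    ∑ x, compA m n d P w x * rv n d γ b j x = rv n d γ b j ((w:ℕ) - m + n) := by
  have hw2 := w.2
  have hlt : (w:ℕ) - m + n < n * d := by
    obtain ⟨e, rfl⟩ : ∃ e, d = e + 1 := ⟨d - 1, by omega⟩
    rw [Nat.mul_succ]
    simp only [Nat.add_sub_cancel] at hw2 
    omega
  rw [Finset.sum_eq_single_of_mem ⟨(w:ℕ) - m + n, hlt⟩ (Finset.mem_univ _)]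
  · simp [compA, Nat.not_lt.2 hw]
  · intro x _ hx
    have : ¬ ((w : ℕ) - m = (x : ℕ) - n ∧ n ≤ (x : ℕ)) := by
      rintro ⟨h1, h2⟩
      apply hx; ext; simp; omega
    simp [compA, Nat.not_lt.2 hw, this]

theorem B_low (w : Fin (m + n*(d-1))) (hw : m ≤ (w:ℕ)) (b j : ℕ) :
    ∑ x, compB m n d P w x * rv n d γ b j x = - rv n d γ b j ((w:ℕ) - m) := by
  have hw2 := w.2
  have hlt : (w:ℕ) - m < n * d := by
    have : n * (d-1) ≤ n * d := Nat.mul_le_mul_left n (by omega)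
    omega
  rw [Finset.sum_eq_single_of_mem ⟨(w:ℕ) - m, hlt⟩ (Finset.mem_univ _)]
  · simp [compB, Nat.not_lt.2 hw]
  · intro x _ hx
    have : ¬ ((x : ℕ) = (w : ℕ) - m) := by
      intro h1
      apply hx; ext; simp; omega
    simp [compB, Nat.not_lt.2 hw, this]

theorem A_high (w : Fin (m + n*(d-1))) (hw : (w:ℕ) < m) (hd : 1 ≤ d) (b j : ℕ) :
    ∑ x, compA m n d P w x * rv n d γ b j x =
      (-1) ^ j * ∑ i : Fin n, P (Fin.last d) ⟨w, hw⟩ i * syl d γ i (d-1) b j := by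
  rw [sum_pos, Finset.mul_sum]
  apply Finset.sum_congr rfl
  intro i _
  rw [Finset.sum_eq_single_of_mem (⟨d - 1, by omega⟩ : Fin d) (Finset.mem_univ _)]
  · rw [rv_pos]
    have : posEquiv n d (i, ⟨d - 1, by omega⟩) = ⟨i, by
        have := Nat.mul_le_mul_left n hd; have := i.2; omega⟩ := by
      ext; simp [posEquiv]
    simp only [this, compA, hw, i.2, dite_true]
    ring
  · intro t _ ht
    have h1 : n ≤ (posEquiv n d (i, t) : ℕ) := by
      have : (t : ℕ) ≠ d - 1 := fun h => ht (by ext; exact h)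
      have h2 := Nat.mul_le_mul_left n (show 1 ≤ d - 1 - (t : ℕ) by omega)
      simp only [posEquiv, Equiv.coe_fn_mk]
      omega
    simp [compA, hw, Nat.not_lt.2 h1]

theorem B_high (w : Fin (m + n*(d-1))) (hw : (w:ℕ) < m) (b j : ℕ) :
    ∑ x, compB m n d P w x * rv n d γ b j x =
      (-1) ^ j * ∑ i : Fin n, ∑ t : Fin d, P t.castSucc ⟨w, hw⟩ i * syl d γ i t b j := by
  rw [sum_pos, Finset.mul_sum]
  apply Finset.sum_congr rfl
  intro i _
  rw [Finset.mul_sum]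
  apply Finset.sum_congr rfl
  intro t _
  rw [rv_pos]
  have hn : 0 < n := by have := i.2; omega
  simp only [compB, hw, hn, dite_true, posEquiv_div, posEquiv_mod]
  have : (⟨d - 1 - (d - 1 - (t:ℕ)), by omega⟩ : Fin (d+1)) = t.castSucc := by
    ext; simp; omega
  rw [this]
  ring


theorem low_div {m n d : ℕ} (w : Fin (m + n*(d-1))) (hw : m ≤ (w:ℕ)) :
    ((w:ℕ) - m) / n < d - 1 := by
  apply Nat.div_lt_of_lt_mul
  have := w.2
  omega

theorem low_n {m n d : ℕ} (w : Fin (m + n*(d-1))) (hw : m ≤ (w:ℕ)) : 0 < n := by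
  rcases Nat.eq_zero_or_pos n with h | h
  · have := w.2; subst h; simp at this; omega
  · exact h

theorem rv_shift {m n d : ℕ} (γ : ℕ → ℕ) (w : Fin (m + n*(d-1))) (hw : m ≤ (w:ℕ)) (b j : ℕ) :
    rv n d γ b j ((w:ℕ) - m + n) =
      (-1) ^ j * syl d γ (((w:ℕ) - m) % n) (d - 2 - ((w:ℕ) - m) / n) b j := by
  unfold rv
  rw [Nat.add_mod_right, Nat.add_div_right _ (low_n w hw)]
  congr 2
  omega

theorem L1 (k : ℕ) (hγ : ∀ b < k, d ≤ γ b) (hd : 1 ≤ d)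
  (hP : ∀ r : Fin m, ∀ b < k, ∀ j ≤ γ b,
        ∑ i : Fin n, ∑ t : Fin (d+1), P t r i * syl d γ i t b j = 0)
    (w : Fin (m + n*(d-1))) (b : ℕ) (hb : b < k) (j : ℕ) (hj : j + 1 < γ b) :
    ∑ x, compA m n d P w x * rv n d γ b j x = ∑ x, compB m n d P w x * rv n d γ b (j+1) x := by
  by_cases hw : (w:ℕ) < m
  · rw [A_high m n d P γ w hw hd, B_high m n d P γ w hw]
    have := hP ⟨w, hw⟩ b hb (j+1) hj.le
    simp only [Fin.sum_univ_castSucc (n := d), Finset.sum_add_distrib] at this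
    obtain ⟨e, rfl⟩ : ∃ e, d = e + 1 := ⟨d - 1, by omega⟩
    simp only [Fin.val_last, syl_succ, Fin.val_castSucc] at this
    rw [eq_neg_of_add_eq_zero_left this, pow_succ]
    simp
  · push Not at hw
    rw [A_low m n d P γ w hw hd, B_low m n d P γ w hw, rv_shift γ w hw]
    unfold rv
    have h1 := low_div w hw
    have : d - 1 - ((w:ℕ) - m) / n = (d - 2 - ((w:ℕ) - m) / n) + 1 := by omega
    rw [this, syl_succ, pow_succ]
    ring

theorem L2 (k : ℕ) (hγ : ∀ b < k, d ≤ γ b) (hd : 1 ≤ d)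
  (hP : ∀ r : Fin m, ∀ b < k, ∀ j ≤ γ b,
        ∑ i : Fin n, ∑ t : Fin (d+1), P t r i * syl d γ i t b j = 0)
    (w : Fin (m + n*(d-1))) (b : ℕ) (hb : b < k) :
    ∑ x, compB m n d P w x * rv n d γ b 0 x = 0 := by
  by_cases hw : (w:ℕ) < m
  · rw [B_high m n d P γ w hw]
    have := hP ⟨w, hw⟩ b hb 0 (by omega)
    simp only [Fin.sum_univ_castSucc (n := d), Finset.sum_add_distrib] at this
    simp only [Fin.val_last, syl_zero d γ _ d _ hd, mul_zero, Finset.sum_const_zero,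
      add_zero, Fin.val_castSucc] at this
    rw [this, mul_zero]
  · push Not at hw
    rw [B_low m n d P γ w hw]
    unfold rv
    have h1 := low_div w hw
    rw [syl_zero _ _ _ _ _ (by omega)]
    simp

theorem L3 (k : ℕ) (hγ : ∀ b < k, d ≤ γ b) (hd : 1 ≤ d)
  (hP : ∀ r : Fin m, ∀ b < k, ∀ j ≤ γ b,
        ∑ i : Fin n, ∑ t : Fin (d+1), P t r i * syl d γ i t b j = 0)
    (w : Fin (m + n*(d-1))) (b : ℕ) (hb : b < k) :
    ∑ x, compA m n d P w x * rv n d γ b (γ b - 1) x = 0 := by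
  have hgb := hγ b hb
  by_cases hw : (w:ℕ) < m
  · rw [A_high m n d P γ w hw hd]
    have := hP ⟨w, hw⟩ b hb (γ b) le_rfl
    simp only [Fin.sum_univ_castSucc (n := d), Finset.sum_add_distrib] at this
    have h0 : ∀ i : Fin n, ∀ t : Fin d, syl d γ i (t.castSucc : Fin (d+1)) b (γ b) = 0 := by
      intro i t
      have := t.2
      exact syl_top _ _ _ _ _ _ (by simp; omega)
    simp only [h0, mul_zero, Finset.sum_const_zero, zero_add, Fin.val_last] at this
    have h2 : ∀ i : Fin n, syl d γ i (d-1) b (γ b - 1) = syl d γ i d b (γ b) := by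
      intro i
      rw [← syl_succ]
      congr 1 <;> omega
    simp only [h2]
    rw [this, mul_zero]
  · push Not at hw
    rw [A_low m n d P γ w hw hd, rv_shift γ w hw]
    have h1 := low_div w hw
    rw [syl_top _ _ _ _ _ _ (by generalize ((w:ℕ) - m) / n = z at *; omega), mul_zero]

end

theorem compA_inj (m n d : ℕ) (hd : 1 ≤ d) (P : Pol d m n)
    (h : LinearIndependent ℂ (P (Fin.last d))) (w : Fin (m + n*(d-1)) → ℂ)
    (hw : w ᵥ* compA m n d P = 0) : w = 0 := by
  have hnd : n + n * (d-1) = n * d := by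
    obtain ⟨e, rfl⟩ : ∃ e, d = e + 1 := ⟨d - 1, by omega⟩
    simp [Nat.mul_succ, Nat.add_comm]
  have h1 : ∀ x : Fin (n*(d-1)), w (Fin.natAdd m x) = 0 := by
    intro x
    have := congrFun hw ⟨n + x, by omega⟩
    simp only [Matrix.vecMul, dotProduct, Fin.sum_univ_add, Pi.zero_apply] at this
    rw [Finset.sum_eq_zero, zero_add, Finset.sum_eq_single_of_mem x (Finset.mem_univ _)] at this
    · simpa [compA] using this
    · intro y _ hy
      have : ¬ ((y:ℕ) = (x:ℕ)) := fun h => hy (by ext; exact h)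
      simp [compA, this]
    · intro y _
      simp [compA]
  have h2 : ∀ i : Fin m, w (Fin.castAdd _ i) = 0 := by
    have h' := Fintype.linearIndependent_iff.1 h
    apply h'
    ext y
    have := congrFun hw ⟨y, by omega⟩
    simp only [Matrix.vecMul, dotProduct, Fin.sum_univ_add, Pi.zero_apply, h1, zero_mul,
      Finset.sum_const_zero, add_zero] at this
    simpa [compA] using this
  ext x
  induction x using Fin.addCases with
  | left i => exact h2 i
  | right i => exact h1 i

theorem core (m n d k : ℕ) (hd : 1 ≤ d) (ρ γ : ℕ → ℕ) (hγ : ∀ b < k, d ≤ γ b)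
    (hρ : ∀ b < k, ρ b + 1 = γ b) (htot : off γ k = n * d) (hk : m + k = n)
    (entA entB : ℕ → ℕ → ℕ → ℂ)
    (hA : ∀ b < k, ∀ i j, entA b i j = if i = j then 1 else 0)
    (hB : ∀ b < k, ∀ i j, entB b i j = if j = i + 1 then 1 else 0) :
    ∃ P : Pol d m n, LinearIndependent ℂ (P (Fin.last d)) ∧
      StrictEquiv (comp m n d P)
        (dsum k ρ γ entA (m + n*(d-1)) (n*d), dsum k ρ γ entB (m + n*(d-1)) (n*d)) := by
  classical
  obtain ⟨P, hli, hP⟩ := exists_poly m n d k γ hγ htot hk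
  refine ⟨P, hli, ?_⟩
  have htotρ : off ρ k = m + n*(d-1) := by
    have h1 : off ρ k + k = off γ k := by
      unfold off
      rw [← Finset.sum_congr rfl (fun b hb => hρ b (by simpa using hb)),
        Finset.sum_add_distrib]
      simp
    obtain ⟨e, rfl⟩ : ∃ e, d = e + 1 := ⟨d - 1, by omega⟩
    rw [Nat.mul_succ] at htot
    simp only [Nat.add_sub_cancel]
    omega
  have hfγ : ∀ y : Fin (n*d), ∃ b < k, off γ b ≤ y ∧ (y:ℕ) < off γ b + γ b :=
    fun y => off_find γ k y (by rw [htot]; exact y.2)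
  have hfρ : ∀ y : Fin (m + n*(d-1)), ∃ b < k, off ρ b ≤ y ∧ (y:ℕ) < off ρ b + ρ b :=
    fun y => off_find ρ k y (by rw [htotρ]; exact y.2)
  choose bg hbg1 hbg2 hbg3 using hfγ
  choose br hbr1 hbr2 hbr3 using hfρ
  let R : Matrix (Fin (n*d)) (Fin (n*d)) ℂ := fun x y => rv n d γ (bg y) (y - off γ (bg y)) x
  let Q : Matrix (Fin (m + n*(d-1))) (Fin (m + n*(d-1))) ℂ := fun w x =>
    ∑ z, compA m n d P w z * rv n d γ (br x) (x - off ρ (br x)) z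
  have hQ : ∀ w (x : Fin (m + n*(d-1))) b j, j < ρ b → (x:ℕ) = off ρ b + j →
      Q w x = ∑ z, compA m n d P w z * rv n d γ b j z := by
    intro w x b j hj hx
    have hb : br x = b := off_unique ρ (hbr2 x) (hbr3 x) (by omega) (by omega)
    have : (x:ℕ) - off ρ b = j := by omega
    simp only [Q, hb, this]
  have hxlt : ∀ b < k, ∀ j < ρ b, off ρ b + j < m + n*(d-1) := by
    intro b hb j hj
    have := off_lt_le ρ hb
    omega
  -- the two identities
  have hsum : ∀ (w : Fin (m + n*(d-1))) (b : ℕ) (hb : b < k) (j : ℕ) (hj : j < ρ b),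
      ∀ g : ℕ → ℂ, (∀ i, g i = if i = j then 1 else 0) →
      ∑ x, Q w x * (if off ρ b ≤ (x:ℕ) ∧ (x:ℕ) < off ρ b + ρ b then g ((x:ℕ) - off ρ b) else 0)
        = ∑ z, compA m n d P w z * rv n d γ b j z := by
    intro w b hb j hj g hg
    rw [Finset.sum_eq_single_of_mem ⟨off ρ b + j, hxlt b hb j hj⟩ (Finset.mem_univ _)]
    · rw [hQ w _ b j hj rfl]
      simp [hj, hg]
    · intro x _ hx
      have hx' : (x:ℕ) ≠ off ρ b + j := fun h => hx (by ext; exact h)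
      split_ifs with hc
      · rw [hg, if_neg (by omega), mul_zero]
      · simp
  have hsum0 : ∀ (w : Fin (m + n*(d-1))) (b : ℕ), 
      ∀ g : ℕ → ℂ, (∀ i < ρ b, g i = 0) →
      ∑ x, Q w x * (if off ρ b ≤ (x:ℕ) ∧ (x:ℕ) < off ρ b + ρ b then g ((x:ℕ) - off ρ b) else 0)
        = 0 := by
    intro w b g hg
    apply Finset.sum_eq_zero
    intro x _
    split_ifs with hc
    · rw [hg _ (by omega), mul_zero]
    · simp
  have hAR : compA m n d P * R = Q * dsum k ρ γ entA (m + n*(d-1)) (n*d) := by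
    ext w y
    have hb := hbg1 y
    have h2 := hbg2 y
    have h3 := hbg3 y
    have hr := hρ _ hb
    rw [Matrix.mul_apply, Matrix.mul_apply]
    simp only [dsum_apply k ρ γ entA _ _ _ y (bg y) hb h2 h3, R]
    by_cases hj : (y:ℕ) - off γ (bg y) < ρ (bg y)
    · rw [hsum w _ hb _ hj (fun i => entA (bg y) i (y - off γ (bg y)))]
      intro i; rw [hA _ hb]
    · rw [hsum0 w _ (fun i => entA (bg y) i (y - off γ (bg y)))]
      · have : (y:ℕ) - off γ (bg y) = γ (bg y) - 1 := by omega
        rw [this]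
        exact L3 m n d P γ k hγ hd hP w _ hb
      · intro i hi; rw [hA _ hb, if_neg (by omega)]
  have hBR : compB m n d P * R = Q * dsum k ρ γ entB (m + n*(d-1)) (n*d) := by
    ext w y
    have hb := hbg1 y
    have h2 := hbg2 y
    have h3 := hbg3 y
    have hr := hρ _ hb
    rw [Matrix.mul_apply, Matrix.mul_apply]
    simp only [dsum_apply k ρ γ entB _ _ _ y (bg y) hb h2 h3, R]
    by_cases hj : (y:ℕ) - off γ (bg y) = 0
    · rw [hsum0 w _ (fun i => entB (bg y) i (y - off γ (bg y)))]
      · rw [hj]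
        exact L2 m n d P γ k hγ hd hP w _ hb
      · intro i hi; rw [hB _ hb, if_neg (by omega)]
    · obtain ⟨j, hj'⟩ : ∃ j, (y:ℕ) - off γ (bg y) = j + 1 := ⟨(y:ℕ) - off γ (bg y) - 1, by omega⟩
      rw [hsum w _ hb j (by omega) (fun i => entB (bg y) i (y - off γ (bg y)))]
      · rw [hj']
        exact (L1 m n d P γ k hγ hd hP w _ hb j (by omega)).symm
      · intro i; rw [hB _ hb, hj']
        simp [eq_comm]
  have hRinj : ∀ v : Fin (n*d) → ℂ, v ᵥ* R = 0 → v = 0 := by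
    intro v hv
    have hz := syl_inj n d k γ hγ htot
      (fun i t => if h : i < n ∧ t < d then v (posEquiv n d (⟨i, h.1⟩, ⟨t, h.2⟩)) else 0) (by
      intro b hb j hj
      have hlt : off γ b + j < n * d := by
        have := off_lt_le γ hb
        omega
      have h0 := congrFun hv ⟨off γ b + j, hlt⟩
      have hbb : bg ⟨off γ b + j, hlt⟩ = b :=
        off_unique γ (hbg2 ⟨off γ b + j, hlt⟩) (hbg3 ⟨off γ b + j, hlt⟩) (by simp) (by simpa using hj)
      simp only [Matrix.vecMul, dotProduct, R, hbb, Nat.add_sub_cancel_left, Pi.zero_apply] at h0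
      rw [sum_pos] at h0
      simp only [rv_pos] at h0
      have hs : (-1 : ℂ) ^ j ≠ 0 := by simp
      apply (mul_eq_zero.1 (?_ : (-1 : ℂ) ^ j * _ = 0)).resolve_left hs
      rw [← h0, Finset.mul_sum]
      rw [Finset.sum_range]
      apply Finset.sum_congr rfl
      intro i _
      rw [Finset.mul_sum, Finset.sum_range]
      apply Finset.sum_congr rfl
      intro t _
      simp
      ring)
    ext y
    obtain ⟨⟨i, t⟩, rfl⟩ := (posEquiv n d).surjective y
    have := hz i i.2 t t.2
    simpa using this
  have hRu : IsUnit R := by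
    rw [← Matrix.vecMul_injective_iff_isUnit]
    intro u v huv
    rw [← sub_eq_zero]
    apply hRinj
    rw [Matrix.sub_vecMul]
    exact sub_eq_zero.2 huv
  have hQu : IsUnit Q := by
    rw [← Matrix.vecMul_injective_iff_isUnit]
    intro u v huv
    rw [← sub_eq_zero]
    apply compA_inj m n d hd P hli
    apply hRinj
    rw [Matrix.vecMul_vecMul, hAR, ← Matrix.vecMul_vecMul, Matrix.sub_vecMul]
    rw [show u ᵥ* Q - v ᵥ* Q = 0 from sub_eq_zero.2 huv, Matrix.zero_vecMul]
  have hdet : IsUnit Q.det := (Matrix.isUnit_iff_isUnit_det Q).1 hQu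
  refine ⟨Q, R, hQu, hRu, ?_, ?_⟩
  · change Q⁻¹ * compA m n d P * R = _
    rw [Matrix.mul_assoc, hAR, Matrix.nonsing_inv_mul_cancel_left _ _ hdet]
  · change Q⁻¹ * compB m n d P * R = _
    rw [Matrix.mul_assoc, hBR, Matrix.nonsing_inv_mul_cancel_left _ _ hdet]

theorem off_sec (c k a : ℕ) (hc : c ≤ k) (u v : ℕ) (γ : ℕ → ℕ)
    (h1 : ∀ b < c, γ b = u) (h2 : ∀ b, c ≤ b → b < k → γ b = v) (h : a = c * u + (k - c) * v) :
    off γ k = a := by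
  subst h
  obtain ⟨e, rfl⟩ := Nat.exists_eq_add_of_le hc
  unfold off
  rw [Finset.sum_range_add, Finset.sum_congr rfl (fun b hb => h1 b (by simpa using hb)),
    Finset.sum_congr rfl (fun b hb => h2 (c + b) (by omega) (by simpa using hb))]
  simp

/-- Case `m < n`:  there is a polynomial of degree exactly `d` and
normal rank exactly `m` whose first companion form is strictly equivalent to `G_rp`. -/
theorem exists_poly_with_Grp_eigenstructure (m n d : ℕ) (hm : 1 ≤ m) (hmn : m < n)
    (hd : 1 ≤ d) :
    ∃ P : Pol d m n, P (Fin.last d) ≠ 0 ∧ nrank P = m ∧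
      StrictEquiv (comp m n d P) (Grp m n d) := by
  have hk : 0 < n - m := by omega
  have hs : m * d % (n - m) < n - m := Nat.mod_lt _ hk
  have hdm := Nat.div_add_mod (m * d) (n - m)
  have hnd : n * d = m * d + (n - m) * d := by rw [← Nat.add_mul]; congr 1; omega
  obtain ⟨P, hli, hP⟩ := core m n d (n - m) hd
    (secSize (m*d % (n-m)) (n-m - m*d % (n-m)) 0 (m*d/(n-m) + d) (m*d/(n-m) + d - 1) (0+1) (0+1))
    (secSize (m*d % (n-m)) (n-m - m*d % (n-m)) 0 (m*d/(n-m) + d + 1) (m*d/(n-m) + d - 1 + 1) 0 0)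
    (by
      intro b hb
      unfold secSize
      generalize m * d / (n - m) = α at *
      split_ifs <;> omega)
    (by
      intro b hb
      unfold secSize
      split_ifs <;> omega)
    (by
      generalize hα : m * d / (n - m) = α at *
      generalize hσ : m * d % (n - m) = σ at *
      apply off_sec σ (n - m) _ hs.le (α + d + 1) (α + d)
      · intro b hb; simp [secSize, hb]
      · intro b h1 h2
        unfold secSize
        split_ifs <;> omega
      · rw [hnd, ← hdm]
        obtain ⟨e, he⟩ := Nat.exists_eq_add_of_le hs.le
        rw [he, Nat.add_sub_cancel_left]
        ring)
    (by omega)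
    (fun _ i j => if i = j then 1 else 0)
    (fun b i j => if b < m*d % (n-m) + (n-m - m*d % (n-m)) then (if j = i+1 then 1 else 0)
       else (if i = j+1 then 1 else 0))
    (fun _ _ _ _ => rfl)
    (by
      intro b hb i j
      rw [if_pos (by omega)])
  refine ⟨P, ?_, nrank_eq m n d P hli, ?_⟩
  · intro h0
    exact hli.ne_zero ⟨0, hm⟩ (by rw [h0]; rfl)
  · have hc : m*d % (n-m) + (n-m - m*d % (n-m)) + 0 + 0 = n - m := by omega
    unfold Grp genPencil
    rw [hc]
    exact hP

end MPoly
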